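/- Tight spreading on neutral terms: if M is a λ-term such that neutral(M), and Φ ▷ Γ ⊢^b M : σ | s is a derivation in the Linear Rank 2 Quantitative Type System such that tight(Γ), then tight(s). -/

import Mathlib

/-! ## λ-terms -/

inductive Term : Type
  | var : ℕ → Term
  | lam : ℕ → Term → Term
  | app : Term → Term → Term

namespace Term

/-- free variables -/
def fv : Term → Finset ℕ
  | .var x => {x}
  | .lam x M => fv M \ {x}
  | .app M N => fv M ∪ fv N

/-- all variables occurring in a term (free, bound or binding) -/
def allVars : Term → Finset ℕ
  | .var x => {x}
  | .lam x M => insert x (allVars M)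
  | .app M N => allVars M ∪ allVars N

/-- substitution `M[N/x]` (as in the paper, under the variable convention) -/
def subst : Term → ℕ → Term → Term
  | .var y, x, N => if y = x then N else .var y
  | .lam y M, x, N => if y = x then .lam y M else .lam y (subst M x N)
  | .app M₁ M₂, x, N => .app (subst M₁ x N) (subst M₂ x N)

/-- simultaneous renaming `M[y₁/x₁, …, yₙ/xₙ]` (the `yᵢ` being fresh) -/
def renList (M : Term) (xs ys : List ℕ) : Term :=
  (xs.zip ys).foldl (fun N q => N.subst q.1 (.var q.2)) M

/-- `M` is an abstraction -/
def IsAbs (M : Term) : Prop := ∃ x N, M = lam x N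

end Term

/-! ## Linear types and linear rank 2 intersection types -/

/-- linear types (linear rank 0 intersection types) -/
inductive LTy : Type
  | var : ℕ → LTy
  | lolly : LTy → LTy → LTy

/-- type variables of a linear type -/
def LTy.tv : LTy → Finset ℕ
  | .var α => {α}
  | .lolly a b => a.tv ∪ b.tv

/-- linear rank 2 intersection types: `σ ::= τ | τ ⊸ σ | (τ₁ ∩ ⋯ ∩ τₙ) → σ`.
Sequences (linear rank 1 types) are multisets of linear types (`∩` is associative,
commutative and non-idempotent); the constraint `n ≥ 2` on `arrow` is enforced in
the typing rules. -/
inductive Ty2 : Type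
  | lin : LTy → Ty2
  | lolly : LTy → Ty2 → Ty2
  | arrow : Multiset LTy → Ty2 → Ty2

/-- `τ ⊸ σ`: identifies `τ ⊸ τ'` (for `τ'` linear) with the linear type `τ ⊸ τ'`,
so that every rank 2 type has a unique representation. -/
def Ty2.mkLolly (τ : LTy) : Ty2 → Ty2
  | .lin τ' => .lin (.lolly τ τ')
  | σ => .lolly τ σ

/-- type variables of a rank 2 type -/
def Ty2.tv : Ty2 → Finset ℕ
  | .lin τ => τ.tv
  | .lolly τ σ => τ.tv ∪ σ.tv
  | .arrow A σ => (A.map LTy.tv).sup ∪ σ.tv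

/-- type substitutions (mapping type variables to linear types) -/
abbrev TSub := ℕ → LTy

def LTy.applyS (S : TSub) : LTy → LTy
  | .var α => S α
  | .lolly a b => .lolly (a.applyS S) (b.applyS S)

def Ty2.applyS (S : TSub) : Ty2 → Ty2
  | .lin τ => .lin (τ.applyS S)
  | .lolly τ σ => .lolly (τ.applyS S) (σ.applyS S)
  | .arrow A σ => .arrow (A.map (LTy.applyS S)) (σ.applyS S)

/-! ## Environments -/

section GEnv
variable {β : Type}

/-- the domain of an environment -/
def domG (Γ : List (ℕ × β)) : List ℕ := Γ.map Prod.fst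

/-- a finite list of declarations is consistent iff the term variables are distinct -/
def consistentG (Γ : List (ℕ × β)) : Prop := (Γ.map Prod.fst).Nodup

/-- the predicate declared for `x` (defaulting to `0`, i.e. empty) -/
def lookupG [Zero β] (Γ : List (ℕ × β)) (x : ℕ) : β :=
  ((Γ.find? (fun p => p.1 == x)).map Prod.snd).getD 0

/-- `Γ₁ + Γ₂`: merge two environments, intersecting the predicates of common
variables; declarations of `Γ₁` come first, in order, followed by the
declarations of variables only in `Γ₂`, in order. -/
def addG [Zero β] [Add β] (Γ₁ Γ₂ : List (ℕ × β)) : List (ℕ × β) :=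
  Γ₁.map (fun p => (p.1, p.2 + lookupG Γ₂ p.1)) ++
    Γ₂.filter (fun p => !((Γ₁.map Prod.fst).contains p.1))

/-- `Σᵢ Γᵢ` -/
def sumG [Zero β] [Add β] (l : List (List (ℕ × β))) : List (ℕ × β) :=
  l.foldr addG []

/-- `Γ_x` : remove the declaration of `x` from `Γ` -/
def eraseG (Γ : List (ℕ × β)) (x : ℕ) : List (ℕ × β) :=
  Γ.filter (fun p => !(p.1 == x))

/-- `Γ[y/x]` : rename the declared variable `x` to `y` -/
def renG (Γ : List (ℕ × β)) (x y : ℕ) : List (ℕ × β) :=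
  Γ.map (fun p => (if p.1 = x then y else p.1, p.2))

/-- `Γ[y₁/x₁, …, yₙ/xₙ]` -/
def renListG (Γ : List (ℕ × β)) (xs ys : List ℕ) : List (ℕ × β) :=
  (xs.zip ys).foldl (fun Δ q => renG Δ q.1 q.2) Γ

end GEnv

/-- environments of the Linear Rank 2 Intersection Type System
(also called `T¹_L`-environments) -/
abbrev Env := List (ℕ × Multiset LTy)

/-- applying a type substitution to an environment -/
def envApplyS (S : TSub) (Γ : Env) : Env :=
  Γ.map (fun p => (p.1, p.2.map (LTy.applyS S)))

/-- the type variables occurring in an environment -/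
def envTv (Γ : Env) : Finset ℕ :=
  Γ.foldr (fun p acc => (p.2.map LTy.tv).sup ∪ acc) ∅

/-- the type variables occurring in a pair (environment, type) -/
def tvOf (Γ : Env) (σ : Ty2) : Finset ℕ := envTv Γ ∪ σ.tv

/-! ## The Linear Rank 2 Intersection Type System (with depth-indexed derivations) -/

/-- `DerN d Γ M σ`: there is a derivation of depth `d` of `Γ ⊢₂ M : σ`. -/
inductive DerN : ℕ → Env → Term → Ty2 → Prop
  | ax (x : ℕ) (τ : LTy) :
      DerN 0 [(x, {τ})] (.var x) (.lin τ)
  | exch (d : ℕ) (Γ₁ Γ₂ : Env) (x y : ℕ) (A B : Multiset LTy) (M : Term) (σ : Ty2) :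
      DerN d (Γ₁ ++ (x, A) :: (y, B) :: Γ₂) M σ →
      DerN (d + 1) (Γ₁ ++ (y, B) :: (x, A) :: Γ₂) M σ
  | contr (d : ℕ) (Γ₁ Γ₂ : Env) (x₁ x₂ x : ℕ) (A B : Multiset LTy) (M : Term) (σ : Ty2) :
      DerN d (Γ₁ ++ (x₁, A) :: (x₂, B) :: Γ₂) M σ →
      x ∉ domG (Γ₁ ++ Γ₂) →
      DerN (d + 1) (Γ₁ ++ (x, A + B) :: Γ₂) ((M.subst x₁ (.var x)).subst x₂ (.var x)) σ
  | introArrow (d : ℕ) (Γ : Env) (x : ℕ) (A : Multiset LTy) (M : Term) (σ : Ty2) :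
      DerN d (Γ ++ [(x, A)]) M σ →
      2 ≤ Multiset.card A →
      DerN (d + 1) Γ (.lam x M) (.arrow A σ)
  | introLolly (d : ℕ) (Γ : Env) (x : ℕ) (τ : LTy) (M : Term) (σ : Ty2) :
      DerN d (Γ ++ [(x, ({τ} : Multiset LTy))]) M σ →
      DerN (d + 1) Γ (.lam x M) (Ty2.mkLolly τ σ)
  | elimLolly (d₁ d₂ : ℕ) (Γ₁ Γ₂ : Env) (M₁ M₂ : Term) (τ : LTy) (σ : Ty2) :
      DerN d₁ Γ₁ M₁ (Ty2.mkLolly τ σ) →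
      DerN d₂ Γ₂ M₂ (.lin τ) →
      consistentG (Γ₁ ++ Γ₂) →
      DerN (max d₁ d₂ + 1) (Γ₁ ++ Γ₂) (.app M₁ M₂) σ
  | elimArrow (d : ℕ) (Γ : Env) (M₁ M₂ : Term) (σ : Ty2) (l : List (ℕ × Env × LTy)) :
      DerN d Γ M₁ (.arrow (Multiset.ofList (l.map (fun p => p.2.2))) σ) →
      (∀ p ∈ l, DerN p.1 p.2.1 M₂ (.lin p.2.2)) →
      2 ≤ l.length →
      consistentG (Γ ++ sumG (l.map (fun p => p.2.1))) →
      DerN (max d ((l.map Prod.fst).foldr max 0) + 1)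
        (Γ ++ sumG (l.map (fun p => p.2.1))) (.app M₁ M₂) σ

/-- `Γ ⊢₂ M : σ` in the Linear Rank 2 Intersection Type System. -/
def Der (Γ : Env) (M : Term) (σ : Ty2) : Prop := ∃ d, DerN d Γ M σ

/-! ## Unification and the type inference algorithm -/

/-- `S` unifies all the equations of `P` -/
def Unifies (S : TSub) (P : List (LTy × LTy)) : Prop :=
  ∀ e ∈ P, LTy.applyS S e.1 = LTy.applyS S e.2

/-- `S` is a most general unifier of `P` -/
def IsMGU (S : TSub) (P : List (LTy × LTy)) : Prop :=
  Unifies S P ∧ ∀ S' : TSub, Unifies S' P →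
    ∃ S'' : TSub, ∀ α, S' α = LTy.applyS S'' (S α)

/-- `Infer M Γ σ` : the type inference algorithm, run on `M`, may return `(Γ, σ)`
(fresh type variables are modelled by disjointness side conditions). -/
inductive Infer : Term → Env → Ty2 → Prop
  | var (x α : ℕ) :
      Infer (.var x) [(x, {LTy.var α})] (.lin (.var α))
  | lamLolly {M₁ : Term} {Γ₁ : Env} {σ₁ : Ty2} (x : ℕ) (τ : LTy) :
      Infer M₁ Γ₁ σ₁ →
      (x, ({τ} : Multiset LTy)) ∈ Γ₁ →
      Infer (.lam x M₁) (eraseG Γ₁ x) (Ty2.mkLolly τ σ₁)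
  | lamArrow {M₁ : Term} {Γ₁ : Env} {σ₁ : Ty2} (x : ℕ) (A : Multiset LTy) :
      Infer M₁ Γ₁ σ₁ →
      (x, A) ∈ Γ₁ →
      2 ≤ Multiset.card A →
      Infer (.lam x M₁) (eraseG Γ₁ x) (.arrow A σ₁)
  | appVar {M₁ M₂ : Term} {Γ₁ Γ₂ : Env} (α₁ : ℕ) (τ₂ : LTy) (α₂ α₃ : ℕ) (S : TSub) :
      Infer M₁ Γ₁ (.lin (.var α₁)) →
      Infer M₂ Γ₂ (.lin τ₂) →
      Disjoint (tvOf Γ₁ (.lin (.var α₁))) (tvOf Γ₂ (.lin τ₂)) →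
      α₂ ∉ tvOf Γ₁ (.lin (.var α₁)) ∪ tvOf Γ₂ (.lin τ₂) →
      α₃ ∉ tvOf Γ₁ (.lin (.var α₁)) ∪ tvOf Γ₂ (.lin τ₂) →
      α₂ ≠ α₃ →
      IsMGU S [(LTy.var α₁, LTy.lolly (.var α₂) (.var α₃)), (τ₂, LTy.var α₂)] →
      Infer (.app M₁ M₂) (envApplyS S (addG Γ₁ Γ₂)) (.lin (S α₃))
  | appArrow {M₁ M₂ : Term} {Γ₁ : Env} {σ₁ : Ty2}
      (l : List (Env × LTy)) (ts : List LTy) (S : TSub) :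
      Infer M₁ Γ₁ (.arrow (Multiset.ofList ts) σ₁) →
      (∀ p ∈ l, Infer M₂ p.1 (.lin p.2)) →
      l.length = ts.length →
      2 ≤ l.length →
      List.Pairwise (fun p q => Disjoint (tvOf p.1 (.lin p.2)) (tvOf q.1 (.lin q.2))) l →
      (∀ p ∈ l, Disjoint (tvOf Γ₁ (.arrow (Multiset.ofList ts) σ₁)) (tvOf p.1 (.lin p.2))) →
      IsMGU S ((l.map Prod.snd).zip ts) →
      Infer (.app M₁ M₂) (envApplyS S (addG Γ₁ (sumG (l.map Prod.fst)))) (Ty2.applyS S σ₁)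
  | appLolly {M₁ M₂ : Term} {Γ₁ Γ₂ : Env} (τ : LTy) (σ₁ : Ty2) (τ₂ : LTy) (S : TSub) :
      Infer M₁ Γ₁ (Ty2.mkLolly τ σ₁) →
      Infer M₂ Γ₂ (.lin τ₂) →
      Disjoint (tvOf Γ₁ (Ty2.mkLolly τ σ₁)) (tvOf Γ₂ (.lin τ₂)) →
      IsMGU S [(τ₂, τ)] →
      Infer (.app M₁ M₂) (envApplyS S (addG Γ₁ Γ₂)) (Ty2.applyS S σ₁)

/-! ## Multi-types and the Linear Rank 2 Quantitative Type System -/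

/-- rank 0 multi-types: `t ::= Neutral | Abs | α | t ⊸ t` -/
inductive MTy : Type
  | Neutral : MTy
  | Abs : MTy
  | var : ℕ → MTy
  | lolly : MTy → MTy → MTy

/-- rank 2 multi-types (rank 1 multi-types are multisets of rank 0 multi-types) -/
inductive MTy2 : Type
  | base : MTy → MTy2
  | lolly : MTy → MTy2 → MTy2
  | arrow : Multiset MTy → MTy2 → MTy2

/-- `t ⊸ s`, identifying `t ⊸ t'` with the rank 0 multi-type `t ⊸ t'` -/
def MTy2.mkLolly (t : MTy) : MTy2 → MTy2
  | .base t' => .base (.lolly t t')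
  | s => .lolly t s

/-- a rank 0 multi-type is tight iff it is one of the tight constants -/
def MTy.tight (t : MTy) : Prop := t = .Neutral ∨ t = .Abs

/-- a rank 1 multi-type is tight iff all its components are -/
def tightSeq (ts : Multiset MTy) : Prop := ∀ t ∈ ts, MTy.tight t

/-- a rank 2 multi-type is tight iff it is a tight constant -/
def MTy2.tight (s : MTy2) : Prop := s = .base .Neutral ∨ s = .base .Abs

/-- environments of the quantitative system: each declaration carries a pair
(sequence of linear types, rank 1 multi-type) -/
abbrev QEnv := List (ℕ × (Multiset LTy × Multiset MTy))

/-- a quantitative environment is tight iff all its multi-type components are -/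
def tightE (Γ : QEnv) : Prop := ∀ p ∈ Γ, tightSeq p.2.2

/-- the Linear Rank 2 Quantitative Type System: `QDer Γ b M σ s` is
`Γ ⊢^b M : σ | s`. -/
inductive QDer : QEnv → ℕ → Term → Ty2 → MTy2 → Prop
  | ax (x : ℕ) (τ : LTy) (t : MTy) :
      QDer [(x, ({τ}, {t}))] 0 (.var x) (.lin τ) (.base t)
  | exch (Γ₁ Γ₂ : QEnv) (x y : ℕ) (A B : Multiset LTy × Multiset MTy)
      (b : ℕ) (M : Term) (σ : Ty2) (s : MTy2) :
      QDer (Γ₁ ++ (x, A) :: (y, B) :: Γ₂) b M σ s →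
      QDer (Γ₁ ++ (y, B) :: (x, A) :: Γ₂) b M σ s
  | contr (Γ₁ Γ₂ : QEnv) (x₁ x₂ x : ℕ) (A₁ A₂ : Multiset LTy × Multiset MTy)
      (b : ℕ) (M : Term) (σ : Ty2) (s : MTy2) :
      QDer (Γ₁ ++ (x₁, A₁) :: (x₂, A₂) :: Γ₂) b M σ s →
      x ∉ domG (Γ₁ ++ Γ₂) →
      QDer (Γ₁ ++ (x, A₁ + A₂) :: Γ₂) b ((M.subst x₁ (.var x)).subst x₂ (.var x)) σ s
  | introLolly (Γ : QEnv) (x : ℕ) (τ : LTy) (t : MTy) (b : ℕ) (M : Term) (σ : Ty2) (s : MTy2) :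
      QDer (Γ ++ [(x, ({τ}, {t}))]) b M σ s →
      QDer Γ (b + 1) (.lam x M) (Ty2.mkLolly τ σ) (MTy2.mkLolly t s)
  | introLollyT (Γ : QEnv) (x : ℕ) (τ : LTy) (t : MTy) (b : ℕ) (M : Term) (σ : Ty2) (s : MTy2) :
      QDer (Γ ++ [(x, ({τ}, {t}))]) b M σ s →
      MTy.tight t →
      MTy2.tight s →
      QDer Γ b (.lam x M) (Ty2.mkLolly τ σ) (.base .Abs)
  | introArrow (Γ : QEnv) (x : ℕ) (A : Multiset LTy) (ts : Multiset MTy)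
      (b : ℕ) (M : Term) (σ : Ty2) (s : MTy2) :
      QDer (Γ ++ [(x, (A, ts))]) b M σ s →
      2 ≤ Multiset.card A →
      Multiset.card ts = Multiset.card A →
      QDer Γ (b + 1) (.lam x M) (.arrow A σ) (.arrow ts s)
  | introArrowT (Γ : QEnv) (x : ℕ) (A : Multiset LTy) (ts : Multiset MTy)
      (b : ℕ) (M : Term) (σ : Ty2) (s : MTy2) :
      QDer (Γ ++ [(x, (A, ts))]) b M σ s →
      2 ≤ Multiset.card A →
      tightSeq ts →
      MTy2.tight s →
      QDer Γ b (.lam x M) (.arrow A σ) (.base .Abs)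
  | elimLolly (Γ₁ Γ₂ : QEnv) (b₁ b₂ : ℕ) (M₁ M₂ : Term) (τ : LTy) (σ : Ty2) (t : MTy) (s : MTy2) :
      QDer Γ₁ b₁ M₁ (Ty2.mkLolly τ σ) (MTy2.mkLolly t s) →
      QDer Γ₂ b₂ M₂ (.lin τ) (.base t) →
      consistentG (Γ₁ ++ Γ₂) →
      QDer (Γ₁ ++ Γ₂) (b₁ + b₂) (.app M₁ M₂) σ s
  | elimLollyT (Γ₁ Γ₂ : QEnv) (b₁ b₂ : ℕ) (M₁ M₂ : Term) (τ : LTy) (σ : Ty2) (s₂ : MTy2) :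
      QDer Γ₁ b₁ M₁ (Ty2.mkLolly τ σ) (.base .Neutral) →
      QDer Γ₂ b₂ M₂ (.lin τ) s₂ →
      MTy2.tight s₂ →
      consistentG (Γ₁ ++ Γ₂) →
      QDer (Γ₁ ++ Γ₂) (b₁ + b₂) (.app M₁ M₂) σ (.base .Neutral)
  | elimArrow (Γ : QEnv) (b : ℕ) (M₁ M₂ : Term) (σ : Ty2) (s : MTy2)
      (l : List (QEnv × ℕ × LTy × MTy)) :
      QDer Γ b M₁ (.arrow (Multiset.ofList (l.map (fun p => p.2.2.1))) σ)
        (.arrow (Multiset.ofList (l.map (fun p => p.2.2.2))) s) →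
      (∀ p ∈ l, QDer p.1 p.2.1 M₂ (.lin p.2.2.1) (.base p.2.2.2)) →
      2 ≤ l.length →
      consistentG (Γ ++ sumG (l.map Prod.fst)) →
      QDer (Γ ++ sumG (l.map Prod.fst)) (b + (l.map (fun p => p.2.1)).sum) (.app M₁ M₂) σ s
  | elimArrowT (Γ : QEnv) (b : ℕ) (M₁ M₂ : Term) (σ : Ty2)
      (l : List (QEnv × ℕ × LTy × MTy2)) :
      QDer Γ b M₁ (.arrow (Multiset.ofList (l.map (fun p => p.2.2.1))) σ) (.base .Neutral) →
      (∀ p ∈ l, QDer p.1 p.2.1 M₂ (.lin p.2.2.1) p.2.2.2) →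
      (∀ p ∈ l, MTy2.tight p.2.2.2) →
      2 ≤ l.length →
      consistentG (Γ ++ sumG (l.map Prod.fst)) →
      QDer (Γ ++ sumG (l.map Prod.fst)) (b + (l.map (fun p => p.2.1)).sum)
        (.app M₁ M₂) σ (.base .Neutral)

/-! ## Leftmost-outermost normal forms and evaluation -/

namespace Term

mutual
  /-- leftmost-outermost neutral terms -/
  inductive Neutral : Term → Prop
    | var (x : ℕ) : Neutral (.var x)
    | app {M N : Term} : Neutral M → Normal N → Neutral (.app M N)
  /-- leftmost-outermost normal terms -/
  inductive Normal : Term → Prop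
    | of_neutral {M : Term} : Neutral M → Normal M
    | lam (x : ℕ) {M : Term} : Normal M → Normal (.lam x M)
end

/-- one step of the leftmost-outermost evaluation strategy -/
inductive Step : Term → Term → Prop
  | beta (x : ℕ) (M N : Term) : Step (.app (.lam x M) N) (M.subst x N)
  | lam (x : ℕ) {M M' : Term} : Step M M' → Step (.lam x M) (.lam x M')
  | appL {M M' N : Term} : Step M M' → ¬ IsAbs M → Step (.app M N) (.app M' N)
  | appR {N M M' : Term} : Neutral N → Step M M' → Step (.app N M) (.app N M')

/-- `StepsN b M N` : `M ⟶^b N`, i.e. `M` reduces to `N` in exactly `b`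
leftmost-outermost steps -/
inductive StepsN : ℕ → Term → Term → Prop
  | refl (M : Term) : StepsN 0 M M
  | step {M M' N : Term} {b : ℕ} : Step M M' → StepsN b M' N → StepsN (b + 1) M N

end Term

/-! ## Quantitative unification and the quantitative type inference algorithm -/

/-- `[τ/α]` applied to a linear type -/
def substVar (τ : LTy) (α : ℕ) : LTy → LTy
  | .var β => if β = α then τ else .var β
  | .lolly a b => .lolly (substVar τ α a) (substVar τ α b)

/-- `[τ/α]` applied to a unification problem -/
def substEqs (τ : LTy) (α : ℕ) (P : Multiset (LTy × LTy)) : Multiset (LTy × LTy) :=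
  P.map (fun e => (substVar τ α e.1, substVar τ α e.2))

/-- `α` occurs in the unification problem `P` -/
def occursIn (α : ℕ) (P : Multiset (LTy × LTy)) : Prop :=
  ∃ e ∈ P, α ∈ e.1.tv ∨ α ∈ e.2.tv

/-- one transformation step `P ⇒ P'` on unification problems; the third component
is `1` for a decomposition step `{τ₁ ⊸ τ₂ = τ₃ ⊸ τ₄} ∪ P ⇒ {τ₁ = τ₃, τ₂ = τ₄} ∪ P`
and `0` otherwise -/
inductive UStep : Multiset (LTy × LTy) → Multiset (LTy × LTy) → ℕ → Prop
  | del (τ : LTy) (P : Multiset (LTy × LTy)) :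
      UStep ((τ, τ) ::ₘ P) P 0
  | dec (a b c d : LTy) (P : Multiset (LTy × LTy)) :
      UStep ((LTy.lolly a b, LTy.lolly c d) ::ₘ P) ((a, c) ::ₘ (b, d) ::ₘ P) 1
  | swap (a b : LTy) (α : ℕ) (P : Multiset (LTy × LTy)) :
      UStep ((LTy.lolly a b, LTy.var α) ::ₘ P) ((LTy.var α, LTy.lolly a b) ::ₘ P) 0
  | elim (α : ℕ) (τ : LTy) (P : Multiset (LTy × LTy)) :
      occursIn α P →
      α ∉ τ.tv →
      UStep ((LTy.var α, τ) ::ₘ P) ((LTy.var α, τ) ::ₘ substEqs τ α P) 0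

/-- iterated transformation steps, accumulating the number of decompositions -/
inductive URun : Multiset (LTy × LTy) → Multiset (LTy × LTy) → ℕ → Prop
  | refl (P : Multiset (LTy × LTy)) : URun P P 0
  | step {P Q R : Multiset (LTy × LTy)} {k b : ℕ} :
      UStep P Q k → URun Q R b → URun P R (k + b)

/-- `P` is in solved form, inducing the substitution `S` -/
def SolvedWith (P : Multiset (LTy × LTy)) (S : TSub) : Prop :=
  ∃ L : List (ℕ × LTy),
    Multiset.ofList (L.map (fun p => (LTy.var p.1, p.2))) = P ∧
    (L.map Prod.fst).Nodup ∧
    (∀ p ∈ L, ∀ q ∈ L, p.1 ∉ q.2.tv) ∧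
    S = fun β => (((L.find? (fun p => p.1 == β)).map Prod.snd).getD (LTy.var β))

/-- `UNIFY_Q(P) = (S, b)`: the quantitative unification algorithm succeeds on `P`
returning the most general unifier `S` and the number `b` of decomposition steps -/
def UnifyQ (P : Multiset (LTy × LTy)) (S : TSub) (b : ℕ) : Prop :=
  ∃ P', URun P P' b ∧ (∀ Q k, ¬ UStep P' Q k) ∧ SolvedWith P' S

/-- `QInfer M Γ σ b` : the quantitative type inference algorithm `T_Q`, run on
`M`, may return `(Γ, σ, b)`. -/
inductive QInfer : Term → Env → Ty2 → ℕ → Prop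
  | var (x α : ℕ) :
      QInfer (.var x) [(x, {LTy.var α})] (.lin (.var α)) 0
  | lamLolly {M₁ : Term} {Γ₁ : Env} {σ₁ : Ty2} {b₁ : ℕ} (x : ℕ) (τ : LTy) :
      QInfer M₁ Γ₁ σ₁ b₁ →
      (x, ({τ} : Multiset LTy)) ∈ Γ₁ →
      QInfer (.lam x M₁) (eraseG Γ₁ x) (Ty2.mkLolly τ σ₁) b₁
  | lamArrow {M₁ : Term} {Γ₁ : Env} {σ₁ : Ty2} {b₁ : ℕ} (x : ℕ) (A : Multiset LTy) :
      QInfer M₁ Γ₁ σ₁ b₁ →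
      (x, A) ∈ Γ₁ →
      2 ≤ Multiset.card A →
      QInfer (.lam x M₁) (eraseG Γ₁ x) (.arrow A σ₁) b₁
  | appVar {M₁ M₂ : Term} {Γ₁ Γ₂ : Env} {b₁ b₂ : ℕ}
      (α₁ : ℕ) (τ₂ : LTy) (α₂ α₃ : ℕ) (S : TSub) (bu : ℕ) :
      QInfer M₁ Γ₁ (.lin (.var α₁)) b₁ →
      QInfer M₂ Γ₂ (.lin τ₂) b₂ →
      Disjoint (tvOf Γ₁ (.lin (.var α₁))) (tvOf Γ₂ (.lin τ₂)) →
      α₂ ∉ tvOf Γ₁ (.lin (.var α₁)) ∪ tvOf Γ₂ (.lin τ₂) →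
      α₃ ∉ tvOf Γ₁ (.lin (.var α₁)) ∪ tvOf Γ₂ (.lin τ₂) →
      α₂ ≠ α₃ →
      UnifyQ {(LTy.var α₁, LTy.lolly (.var α₂) (.var α₃)), (τ₂, LTy.var α₂)} S bu →
      QInfer (.app M₁ M₂) (envApplyS S (addG Γ₁ Γ₂)) (.lin (S α₃)) (b₁ + b₂)
  | appArrow {M₁ M₂ : Term} {Γ₁ : Env} {σ₁ : Ty2} {b₁ : ℕ}
      (l : List (Env × LTy × ℕ)) (ts : List LTy) (S : TSub) (bu : ℕ) :
      QInfer M₁ Γ₁ (.arrow (Multiset.ofList ts) σ₁) b₁ →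
      (∀ p ∈ l, QInfer M₂ p.1 (.lin p.2.1) p.2.2) →
      l.length = ts.length →
      2 ≤ l.length →
      List.Pairwise (fun p q => Disjoint (tvOf p.1 (.lin p.2.1)) (tvOf q.1 (.lin q.2.1))) l →
      (∀ p ∈ l, Disjoint (tvOf Γ₁ (.arrow (Multiset.ofList ts) σ₁)) (tvOf p.1 (.lin p.2.1))) →
      UnifyQ (Multiset.ofList ((l.map (fun p => p.2.1)).zip ts)) S bu →
      QInfer (.app M₁ M₂) (envApplyS S (addG Γ₁ (sumG (l.map Prod.fst)))) (Ty2.applyS S σ₁)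
        (b₁ + (l.map (fun p => p.2.2)).sum + bu + 1)
  | appLolly {M₁ M₂ : Term} {Γ₁ Γ₂ : Env} {b₁ b₂ : ℕ}
      (τ : LTy) (σ₁ : Ty2) (τ₂ : LTy) (S : TSub) (bu : ℕ) :
      QInfer M₁ Γ₁ (Ty2.mkLolly τ σ₁) b₁ →
      QInfer M₂ Γ₂ (.lin τ₂) b₂ →
      Disjoint (tvOf Γ₁ (Ty2.mkLolly τ σ₁)) (tvOf Γ₂ (.lin τ₂)) →
      UnifyQ {(τ₂, τ)} S bu →
      QInfer (.app M₁ M₂) (envApplyS S (addG Γ₁ Γ₂)) (Ty2.applyS S σ₁) (b₁ + b₂ + bu + 1)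

mutual
  theorem Term.Neutral.of_subst_var {x y : ℕ} :
      ∀ (M : Term), (M.subst x (.var y)).Neutral → M.Neutral
    | .var z, _ => .var z
    | .lam z M, h => by
        rw [Term.subst] at h
        split at h <;> cases h
    | .app M N, h => by
        rw [Term.subst] at h
        cases h with
        | app hM hN => exact .app (Neutral.of_subst_var M hM) (Normal.of_subst_var N hN)

  theorem Term.Normal.of_subst_var {x y : ℕ} :
      ∀ (M : Term), (M.subst x (.var y)).Normal → M.Normal
    | .var z, _ => .of_neutral (.var z)
    | .lam z M, h => by
        rw [Term.subst] at h
        split at h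
        · exact h
        · cases h with
          | of_neutral h => cases h
          | lam _ h => exact .lam z (Normal.of_subst_var M h)
    | .app M N, h => by
        rw [Term.subst] at h
        cases h with
        | of_neutral h =>
          cases h with
          | app hM hN =>
            exact .of_neutral (.app (Neutral.of_subst_var M hM) (Normal.of_subst_var N hN))
end

theorem MTy2.not_tight_mkLolly (t : MTy) (s : MTy2) : ¬ (MTy2.mkLolly t s).tight := by
  cases s <;> simp [MTy2.mkLolly, MTy2.tight]

theorem MTy2.not_tight_arrow (ts : Multiset MTy) (s : MTy2) : ¬ (MTy2.arrow ts s).tight := by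
  simp [MTy2.tight]

theorem tightE_append {Γ₁ Γ₂ : QEnv} : tightE (Γ₁ ++ Γ₂) ↔ tightE Γ₁ ∧ tightE Γ₂ :=
  List.forall_mem_append

theorem tightE_cons {p : ℕ × (Multiset LTy × Multiset MTy)} {Γ : QEnv} :
    tightE (p :: Γ) ↔ tightSeq p.2.2 ∧ tightE Γ :=
  List.forall_mem_cons

theorem tightSeq_add {ts us : Multiset MTy} :
    tightSeq (ts + us) ↔ tightSeq ts ∧ tightSeq us := by
  simp only [tightSeq, Multiset.mem_add, or_imp, forall_and]

/-- **Tight spreading on neutral terms.** If `neutral(M)` and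
`Φ ▷ Γ ⊢^b M : σ | s` with `tight(Γ)`, then `tight(s)`. -/
theorem tight_spreading (M : Term) (Γ : QEnv) (b : ℕ) (σ : Ty2) (s : MTy2)
    (hM : M.Neutral) (h : QDer Γ b M σ s) (hΓ : tightE Γ) :
    MTy2.tight s := by
  induction h with
  | ax x τ t => simpa [tightE, tightSeq, MTy.tight, MTy2.tight] using hΓ
  | exch Γ₁ Γ₂ x y A B b M σ s _ ih =>
    refine ih hM ?_
    simp only [tightE_append, tightE_cons] at hΓ ⊢
    tauto
  | contr Γ₁ Γ₂ x₁ x₂ x A₁ A₂ b M σ s _ _ ih =>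
    refine ih (.of_subst_var _ (.of_subst_var _ hM)) ?_
    simp only [tightE_append, tightE_cons, Prod.snd_add, tightSeq_add] at hΓ ⊢
    tauto
  | introLolly | introLollyT | introArrow | introArrowT => cases hM
  | elimLolly Γ₁ Γ₂ b₁ b₂ M₁ M₂ τ σ t s _ _ _ ih _ =>
    cases hM with
    | app hM₁ _ => exact absurd (ih hM₁ (tightE_append.1 hΓ).1) (MTy2.not_tight_mkLolly t s)
  | elimArrow Γ b M₁ M₂ σ s l _ _ _ _ ih _ =>
    cases hM with
    | app hM₁ _ => exact absurd (ih hM₁ (tightE_append.1 hΓ).1) (MTy2.not_tight_arrow _ s)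
  | elimLollyT | elimArrowT => exact .inl rfl
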